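/- arXiv:math/0605297 — 4 statements merged into one kernel-verified Lean document; each statement's English description precedes it below -/
import Mathlib

section
/- For every integer n ≥ 1 one has B_n = -n!·I_n, where B_n is the n-th Bernoulli number and the rational numbers I_n are defined recursively from the polynomials φ_n ∈ ℚ[t] by φ_1(t) = t, I_n = ∫₀¹ φ_n(t) dt, and φ_{n+1}(t) = ∫₀^t φ_n(s) ds − t·I_n. -/
open Polynomial

/-- The formal antiderivative of a polynomial (with zero constant term):
`∫₀ᵗ p`, sending `a·tⁿ` to `a/(n+1)·tⁿ⁺¹`. -/
noncomputable def integralPoly (p : ℚ[X]) : ℚ[X] :=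
  p.sum fun n a => Polynomial.C (a / ((n : ℚ) + 1)) * Polynomial.X ^ (n + 1)

/-- The polynomials `φ_n ∈ ℚ[t]`, defined recursively by `φ₁(t) = t`,
`φ_{n+1}(t) = ∫₀ᵗ φ_n(s) ds − t·I_n`, where `I_n = ∫₀¹ φ_n(t) dt`
(the formal antiderivative evaluated at the endpoints). -/
noncomputable def phiP : ℕ → ℚ[X]
  | 0 => 0
  | 1 => Polynomial.X
  | n + 2 =>
    integralPoly (phiP (n + 1)) -
      Polynomial.C ((integralPoly (phiP (n + 1))).eval 1 -
        (integralPoly (phiP (n + 1))).eval 0) * Polynomial.X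

/-- `I_n = ∫₀¹ φ_n(t) dt`, the formal antiderivative evaluated at the endpoints. -/
noncomputable def Ival (n : ℕ) : ℚ :=
  (integralPoly (phiP n)).eval 1 - (integralPoly (phiP n)).eval 0

theorem coeff_succ_integralPoly (p : ℚ[X]) (k : ℕ) :
    (integralPoly p).coeff (k + 1) = p.coeff k / ((k : ℚ) + 1) := by
  unfold integralPoly
  rw [Polynomial.sum_def, Polynomial.finsetSum_coeff]
  simp only [Polynomial.coeff_C_mul, Polynomial.coeff_X_pow, add_left_inj, mul_ite, mul_one,
    mul_zero, Finset.sum_ite_eq]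
  split_ifs with h
  · rfl
  · rw [Polynomial.notMem_support_iff.mp h, zero_div]

theorem coeff_zero_integralPoly (p : ℚ[X]) : (integralPoly p).coeff 0 = 0 := by
  unfold integralPoly
  rw [Polynomial.sum_def, Polynomial.finsetSum_coeff]
  apply Finset.sum_eq_zero
  intro i _
  simp [Polynomial.coeff_X_pow]

theorem integralPoly_derivative (q : ℚ[X]) :
    integralPoly (derivative q) = q - C (q.eval 0) := by
  ext k
  cases k with
  | zero => rw [coeff_zero_integralPoly, coeff_sub, coeff_C_zero, coeff_zero_eq_eval_zero, sub_self]
  | succ k =>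
    have : (k : ℚ) + 1 ≠ 0 := by positivity
    rw [coeff_succ_integralPoly, Polynomial.coeff_derivative, Polynomial.coeff_sub,
      Polynomial.coeff_C_succ]
    field_simp
    ring

theorem integralPoly_aux (n : ℕ) (p : ℚ[X])
    (h : p = C (1 / ((n + 1).factorial : ℚ)) *
      (Polynomial.bernoulli (n + 1) - C (_root_.bernoulli (n + 1)))) :
    integralPoly p = C (1 / ((n + 2).factorial : ℚ)) *
      (Polynomial.bernoulli (n + 2) - C (_root_.bernoulli (n + 2)))
      - C (_root_.bernoulli (n + 1) / ((n + 1).factorial : ℚ)) * X := by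
  have hd : p = derivative (C (1 / ((n + 2).factorial : ℚ)) * Polynomial.bernoulli (n + 2)
      - C (_root_.bernoulli (n + 1) / ((n + 1).factorial : ℚ)) * X) := by
    have e : (1 / ((n + 1).factorial : ℚ)) = 1 / ((n + 2).factorial : ℚ) * ((n + 1 : ℕ) + 1) := by
      rw [Nat.factorial_succ (n + 1)]
      have := Nat.factorial_ne_zero (n + 1)
      push_cast
      field_simp
      try ring
    have e2 : C (1 / ((n + 1).factorial : ℚ))
        = C (1 / ((n + 2).factorial : ℚ)) * (((n + 1 : ℕ) : ℚ[X]) + 1) := by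
      rw [e]; simp
    have e3 : C (_root_.bernoulli (n + 1) / ((n + 1).factorial : ℚ))
        = C (1 / ((n + 1).factorial : ℚ)) * C (_root_.bernoulli (n + 1)) := by
      rw [← C_mul]; congr 1; ring
    rw [derivative_sub, derivative_C_mul, derivative_C_mul, derivative_X,
      Polynomial.derivative_bernoulli_add_one, h, e3, e2]
    ring
  rw [hd, integralPoly_derivative]
  simp only [eval_sub, eval_mul, eval_C, eval_X, Polynomial.bernoulli_eval_zero, C_mul, C_sub,
    mul_zero, sub_zero]
  ring

theorem Ival_aux (n : ℕ)
    (h : phiP (n + 1) = C (1 / ((n + 1).factorial : ℚ)) *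
      (Polynomial.bernoulli (n + 1) - C (_root_.bernoulli (n + 1)))) :
    Ival (n + 1) = - (_root_.bernoulli (n + 1) / ((n + 1).factorial : ℚ)) := by
  unfold Ival
  rw [integralPoly_aux n _ h]
  have : bernoulli' (n + 2) = _root_.bernoulli (n + 2) :=
    (bernoulli_eq_bernoulli'_of_ne_one (by omega)).symm
  simp [Polynomial.bernoulli_eval_zero, Polynomial.bernoulli_eval_one, this]

theorem phiP_eq (n : ℕ) :
    phiP (n + 1) = C (1 / ((n + 1).factorial : ℚ)) *
      (Polynomial.bernoulli (n + 1) - C (_root_.bernoulli (n + 1))) := by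
  induction n with
  | zero =>
    simp only [phiP, zero_add, Polynomial.bernoulli_one, _root_.bernoulli_one]
    rw [sub_sub, ← C_add]
    norm_num
  | succ n ih =>
    have h := Ival_aux n ih
    have : phiP (n + 1 + 1) = integralPoly (phiP (n + 1)) - C (Ival (n + 1)) * X := rfl
    rw [this, h, integralPoly_aux n _ ih, C_neg]
    ring

/-- For every `n ≥ 1` one has `B_n = -n!·I_n`, where `B_n` is the `n`-th Bernoulli
number (defined by `x/(eˣ-1) = Σ B_n xⁿ/n!`). -/
theorem bernoulli_eq_neg_factorial_mul_Ival (n : ℕ) (hn : 1 ≤ n) :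
    _root_.bernoulli n = -(n.factorial : ℚ) * Ival n := by
  obtain ⟨m, rfl⟩ : ∃ m, n = m + 1 := ⟨n - 1, by omega⟩
  rw [Ival_aux m (phiP_eq m)]
  have := Nat.factorial_ne_zero (m + 1)
  field_simp
end

section
/- Let A, B, C, D, E be cochain complexes of vector spaces over a field K, with morphisms of complexes α: A → C, β: C → E, φ: B → C, ψ: C → D such that 0 → A →^α C →^β E → 0 and 0 → B →^φ C →^ψ D → 0 are short exact sequences of complexes (exact in each degree). If ψ∘α: A → D is a quasi-isomorphism, then β∘φ: B → E is a quasi-isomorphism. -/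
universe u

/-- A cochain complex of `K`-vector spaces, given by its components and its
degree-one differential.  (The condition `d ∘ d = 0` is `Cx.IsComplex`.) -/
structure Cx (K : Type u) [Field K] where
  V : ℤ → Type u
  [acg : ∀ i, AddCommGroup (V i)]
  [mod : ∀ i, Module K (V i)]
  d : ∀ i, V i →ₗ[K] V (i + 1)

attribute [instance] Cx.acg Cx.mod

/-- Transport along an equality of degrees. -/
def castL (K : Type u) [Field K] (V : ℤ → Type u) [∀ i, AddCommGroup (V i)] [∀ i, Module K (V i)] {i j : ℤ}
    (h : i = j) : V i →ₗ[K] V j where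
  toFun x := h ▸ x
  map_add' := by subst h; intros; rfl
  map_smul' := by subst h; intros; rfl

variable {K : Type u} [Field K]

/-- The differential squares to zero. -/
def Cx.IsComplex (A : Cx K) : Prop := ∀ (i : ℤ) (x : A.V i), A.d (i + 1) (A.d i x) = 0

/-- A family of linear maps is a morphism of complexes if it commutes with the
differentials. -/
def IsChainMap (A B : Cx K) (f : ∀ i, A.V i →ₗ[K] B.V i) : Prop :=
  ∀ (i : ℤ) (x : A.V i), f (i + 1) (A.d i x) = B.d i (f i x)

/-- A morphism of complexes is a quasi-isomorphism if it induces an isomorphism on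
cohomology in every degree: a cocycle of `A` whose image is a coboundary is a
coboundary, and every cocycle of `B` is, modulo coboundaries, the image of a
cocycle of `A`. -/
def IsQuasiIso (A B : Cx K) (f : ∀ i, A.V i →ₗ[K] B.V i) : Prop :=
  ∀ n : ℤ,
    (∀ x : A.V (n + 1), A.d (n + 1) x = 0 → (∃ w, B.d n w = f (n + 1) x) →
      ∃ v, A.d n v = x) ∧
    (∀ y : B.V (n + 1), B.d (n + 1) y = 0 →
      ∃ x : A.V (n + 1), A.d (n + 1) x = 0 ∧ ∃ w, B.d n w = y - f (n + 1) x)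

/-- A complex is acyclic if all its cohomology vanishes. -/
def Cx.Acyclic (A : Cx K) : Prop :=
  ∀ (n : ℤ) (x : A.V (n + 1)), A.d (n + 1) x = 0 → ∃ y, A.d n y = x

/-- Let `A, B, C, D, E` be cochain complexes of vector spaces over a field `K`,
with morphisms of complexes `α : A → C`, `β : C → E`, `φ : B → C`, `ψ : C → D`
fitting into two short exact sequences `0 → A → C → E → 0` and
`0 → B → C → D → 0` (exact in each degree).  If `ψ∘α : A → D` is a
quasi-isomorphism, then `β∘φ : B → E` is a quasi-isomorphism. -/
theorem quasiIso_of_cross (A B C D E : Cx K)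
    (hA : A.IsComplex) (hB : B.IsComplex) (hC : C.IsComplex) (hD : D.IsComplex)
    (hE : E.IsComplex)
    (α : ∀ i, A.V i →ₗ[K] C.V i) (hα : IsChainMap A C α)
    (β : ∀ i, C.V i →ₗ[K] E.V i) (hβ : IsChainMap C E β)
    (φ : ∀ i, B.V i →ₗ[K] C.V i) (hφ : IsChainMap B C φ)
    (ψ : ∀ i, C.V i →ₗ[K] D.V i) (hψ : IsChainMap C D ψ)
    (hαinj : ∀ i, Function.Injective (α i))
    (hαβ : ∀ i, LinearMap.range (α i) = LinearMap.ker (β i))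
    (hβsurj : ∀ i, Function.Surjective (β i))
    (hφinj : ∀ i, Function.Injective (φ i))
    (hφψ : ∀ i, LinearMap.range (φ i) = LinearMap.ker (ψ i))
    (hψsurj : ∀ i, Function.Surjective (ψ i))
    (hqis : IsQuasiIso A D (fun i => (ψ i) ∘ₗ (α i))) :
    IsQuasiIso B E (fun i => (β i) ∘ₗ (φ i)) := by
  have exA : ∀ i (c : C.V i), β i c = 0 → ∃ a, α i a = c := fun i c h => by
    have : c ∈ LinearMap.range (α i) := by rw [hαβ]; exact h
    exact this
  have exB : ∀ i (c : C.V i), ψ i c = 0 → ∃ b, φ i b = c := fun i c h => by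
    have : c ∈ LinearMap.range (φ i) := by rw [hφψ]; exact h
    exact this
  have zA : ∀ i a, β i (α i a) = 0 := fun i a => by
    have : α i a ∈ LinearMap.ker (β i) := by rw [← hαβ]; exact ⟨a, rfl⟩
    exact this
  have zB : ∀ i b, ψ i (φ i b) = 0 := fun i b => by
    have : φ i b ∈ LinearMap.ker (ψ i) := by rw [← hφψ]; exact ⟨b, rfl⟩
    exact this
  -- a cocycle-producing step: correct an element with closed image in `D`
  have key : ∀ n (c : C.V (n + 1)), D.d (n + 1) (ψ (n + 1) c) = 0 →
      ∃ a b c', A.d (n + 1) a = 0 ∧ φ (n + 1) b = c - α (n + 1) a - C.d n c' := by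
    intro n c hc
    obtain ⟨a, ha, w, hw⟩ := (hqis n).2 _ hc
    obtain ⟨c', rfl⟩ := hψsurj n w
    obtain ⟨b, hb⟩ := exB (n + 1) (c - α (n + 1) a - C.d n c') (by
      rw [map_sub, map_sub, hψ, hw]
      simp)
    exact ⟨a, b, c', ha, hb⟩
  intro n
  constructor
  · rintro b hb ⟨e, he⟩
    obtain ⟨c, rfl⟩ := hβsurj n e
    simp only [LinearMap.comp_apply] at he
    obtain ⟨a, ha⟩ := exA (n + 1) (φ (n + 1) b - C.d n c) (by
      rw [map_sub, hβ, he, sub_self])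
    have hda : A.d (n + 1) a = 0 := by
      apply hαinj
      rw [hα, ha, map_sub, ← hφ, hb, hC]
      simp
    obtain ⟨v, rfl⟩ := (hqis n).1 a hda ⟨- ψ n c, by
      simp only [LinearMap.comp_apply]
      rw [ha, map_sub, zB, hψ, map_neg, zero_sub]⟩
    have h1 : C.d n (c + α n v) = φ (n + 1) b := by
      rw [map_add, ← hα, ha]; abel
    have h2 : D.d n (ψ n (c + α n v)) = 0 := by
      rw [← hψ, h1, zB]
    obtain ⟨m, rfl⟩ : ∃ m, n = m + 1 := ⟨n - 1, by ring⟩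
    obtain ⟨a', b', c', ha', hb'⟩ := key m _ h2
    refine ⟨b', hφinj _ ?_⟩
    rw [hφ, hb', map_sub, map_sub, h1, ← hα, ha', hC]
    simp
  · intro e he
    obtain ⟨c, rfl⟩ := hβsurj (n + 1) e
    obtain ⟨a, ha⟩ := exA (n + 1 + 1) (C.d (n + 1) c) (by rw [hβ, he])
    have hda : A.d (n + 1 + 1) a = 0 := by
      apply hαinj
      rw [hα, ha, hC]
      simp
    obtain ⟨v, rfl⟩ := (hqis (n + 1)).1 a hda ⟨ψ (n + 1) c, by
      simp only [LinearMap.comp_apply]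
      rw [ha, hψ]⟩
    have h1 : C.d (n + 1) (c - α (n + 1) v) = 0 := by
      rw [map_sub, ← hα, ha, sub_self]
    obtain ⟨a', b', c', ha', hb'⟩ := key n (c - α (n + 1) v) (by
      rw [← hψ, h1, map_zero])
    refine ⟨b', hφinj _ ?_, β n c', ?_⟩
    · rw [hφ, hb', map_sub, map_sub, h1, ← hα, ha', hC]
      simp
    · simp only [LinearMap.comp_apply]
      rw [hb', map_sub, map_sub, map_sub, zA, zA, hβ]
      abel
end

section
/- Let V ⊆ W be a subcomplex of a cochain complex of vector spaces over a field K such that the inclusion V → W is a quasi-isomorphism. Let L_{V,W} ⊆ Hom*(W, W) be the subcomplex with L_{V,W}^n = { f ∈ Hom^n(W, W) : f(V^j) ⊆ V^{j+n} for all j }. Then both the inclusion L_{V,W} → Hom*(W, W) and the restriction map L_{V,W} → Hom*(V, V), f ↦ f|_V, are quasi-isomorphisms. -/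
universe u

variable {K : Type u} [Field K]

/-- The degree-`n` component `Hom^n(A, B) = Π_j Hom(A^j, B^{j+n})` of the Hom
complex. -/
abbrev homV (A B : Cx K) (n : ℤ) : Type u := ∀ j : ℤ, A.V j →ₗ[K] B.V (j + n)

/-- The differential `δ(f) = d_B ∘ f − (−1)ⁿ f ∘ d_A` of the Hom complex. -/
def homD (A B : Cx K) (n : ℤ) : homV A B n →ₗ[K] homV A B (n + 1) where
  toFun f := fun j =>
    castL K B.V (show j + n + 1 = j + (n + 1) by omega) ∘ₗ B.d (j + n) ∘ₗ f j -
      ((-1 : K) ^ n) • (castL K B.V (show j + 1 + n = j + (n + 1) by omega) ∘ₗ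
        f (j + 1) ∘ₗ A.d j)
  map_add' f g := by
    funext j; ext x
    simp [smul_add]
    abel
  map_smul' c f := by
    funext j; ext x
    simp [smul_comm c, smul_sub]

/-- The Hom complex `Hom*(A, B)`. -/
def homCx (A B : Cx K) : Cx K where
  V n := homV A B n
  d n := homD A B n

/-- The subcomplex determined by a family of submodules preserved by the
differential. -/
def subCx (W : Cx K) (S : ∀ i, Submodule K (W.V i))
    (hS : ∀ i, ∀ x ∈ S i, W.d i x ∈ S (i + 1)) : Cx K where
  V i := ↥(S i)
  d i := (W.d i).restrict (hS i)

/-- The submodule `L_{V,W}^n ⊆ Hom^n(W, W)` of homogeneous maps preserving the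
subcomplex `S`. -/
def presSub (W : Cx K) (S : ∀ i, Submodule K (W.V i)) (n : ℤ) :
    Submodule K (homV W W n) where
  carrier := { f | ∀ j, ∀ x ∈ S j, f j x ∈ S (j + n) }
  add_mem' hf hg j x hx := by
    simpa using Submodule.add_mem _ (hf j x hx) (hg j x hx)
  zero_mem' j x hx := by simp
  smul_mem' c f hf j x hx := by
    simpa using Submodule.smul_mem _ c (hf j x hx)

lemma mem_presSub {W : Cx K} {S : ∀ i, Submodule K (W.V i)} {n : ℤ} {f : homV W W n} :
    f ∈ presSub W S n ↔ ∀ j, ∀ x ∈ S j, f j x ∈ S (j + n) := Iff.rfl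

lemma castL_mem {V : ℤ → Type u} [∀ i, AddCommGroup (V i)] [∀ i, Module K (V i)]
    (S : ∀ i, Submodule K (V i)) {i j : ℤ} (h : i = j) {x : V i} (hx : x ∈ S i) :
    castL K V h x ∈ S j := by subst h; exact hx

lemma homD_pres (W : Cx K) (S : ∀ i, Submodule K (W.V i))
    (hS : ∀ i, ∀ x ∈ S i, W.d i x ∈ S (i + 1)) (n : ℤ) :
    ∀ f ∈ presSub W S n, homD W W n f ∈ presSub W S (n + 1) := by
  intro f hf j x hx
  show (homD W W n f) j x ∈ _
  simp only [homD, LinearMap.coe_mk, AddHom.coe_mk, Pi.sub_apply, Pi.smul_apply,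
    LinearMap.sub_apply, LinearMap.smul_apply, LinearMap.comp_apply]
  exact Submodule.sub_mem _ (castL_mem S _ (hS _ _ (hf j x hx)))
    (Submodule.smul_mem _ _ (castL_mem S _ (hf (j + 1) _ (hS j x hx))))

/-- The subcomplex `L_{V,W} ⊆ Hom*(W, W)` of maps preserving `S`, as a complex. -/
def presCx (W : Cx K) (S : ∀ i, Submodule K (W.V i))
    (hS : ∀ i, ∀ x ∈ S i, W.d i x ∈ S (i + 1)) : Cx K where
  V n := ↥(presSub W S n)
  d n := (homD W W n).restrict (homD_pres W S hS n)

/-- The restriction map `L_{V,W} → Hom*(V, V)`, `f ↦ f|_V`. -/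
def resMap (W : Cx K) (S : ∀ i, Submodule K (W.V i))
    (hS : ∀ i, ∀ x ∈ S i, W.d i x ∈ S (i + 1)) (n : ℤ) :
    ↥(presSub W S n) →ₗ[K] homV (subCx W S hS) (subCx W S hS) n where
  toFun f := fun j => (f.1 j).restrict (f.2 j)
  map_add' f g := by
    funext j; apply LinearMap.ext; intro x; apply Subtype.ext; rfl
  map_smul' c f := by
    funext j; apply LinearMap.ext; intro x; apply Subtype.ext; rfl

lemma castL_castL {V : ℤ → Type u} [∀ i, AddCommGroup (V i)] [∀ i, Module K (V i)]
    {i j k : ℤ} (h : i = j) (h' : j = k) (x : V i) :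
    castL K V h' (castL K V h x) = castL K V (h.trans h') x := by
  subst h; subst h'; rfl

lemma castL_self {V : ℤ → Type u} [∀ i, AddCommGroup (V i)] [∀ i, Module K (V i)]
    {i : ℤ} (h : i = i) (x : V i) : castL K V h x = x := rfl

lemma map_castL {V V' : ℤ → Type u} [∀ i, AddCommGroup (V i)] [∀ i, Module K (V i)]
    [∀ i, AddCommGroup (V' i)] [∀ i, Module K (V' i)] (φ ψ : ℤ → ℤ)
    (F : ∀ i, V (ψ i) →ₗ[K] V' (φ i)) {i j : ℤ} (h : i = j) (h' : ψ i = ψ j) (x : V (ψ i)) :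
    F j (castL K V h' x) = castL K V' (congrArg φ h) (F i x) := by
  subst h; rfl

lemma homD_apply' (A B : Cx K) (n : ℤ) (f : homV A B n) (j : ℤ) (x : A.V j) :
    homD A B n f j x = castL K B.V (show j + n + 1 = j + (n + 1) by omega) (B.d (j + n) (f j x)) -
      ((-1 : K) ^ n) • (castL K B.V (show j + 1 + n = j + (n + 1) by omega)
        (f (j + 1) (A.d j x))) := rfl

/-- Two-sided composition with degree-zero families. -/
def sandwich {A A' B B' : Cx K} (q : ∀ i, A'.V i →ₗ[K] A.V i) (g : ∀ i, B.V i →ₗ[K] B'.V i)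
    (n : ℤ) (f : homV A B n) : homV A' B' n := fun j => g (j + n) ∘ₗ f j ∘ₗ q j

lemma homD_sandwich {A A' B B' : Cx K} (q : ∀ i, A'.V i →ₗ[K] A.V i)
    (g : ∀ i, B.V i →ₗ[K] B'.V i) (hq : IsChainMap A' A q) (hg : IsChainMap B B' g)
    (n : ℤ) (f : homV A B n) :
    homD A' B' n (sandwich q g n f) = sandwich q g (n + 1) (homD A B n f) := by
  funext j
  apply LinearMap.ext
  intro x
  have hc : ∀ {i k : ℤ} (e : i = k) (x : B.V i),
      g k (castL K B.V e x) = castL K B'.V e (g i x) := by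
    intro i k e x; subst e; rfl
  simp only [homD_apply', sandwich, LinearMap.comp_apply, map_sub, map_smul, hc, hg _ _, hq _ _]

lemma exists_genInv {A B : Type u} [AddCommGroup A] [Module K A] [AddCommGroup B] [Module K B]
    (f : A →ₗ[K] B) : ∃ g : B →ₗ[K] A, ∀ x, f (g (f x)) = f x := by
  obtain ⟨g, hg⟩ := f.rangeRestrict.exists_rightInverse_of_surjective f.range_rangeRestrict
  obtain ⟨g', hg'⟩ := LinearMap.exists_extend g
  refine ⟨g', fun x => ?_⟩
  have h1 : g' (f x) = g (f.rangeRestrict x) := by rw [← hg']; rfl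
  rw [h1]
  have := congrArg Subtype.val (LinearMap.congr_fun hg (f.rangeRestrict x))
  simpa using this

lemma exists_h (W : Cx K) (hW : W.IsComplex)
    (S : ∀ i, Submodule K (W.V i))
    (hS : ∀ i, ∀ x ∈ S i, W.d i x ∈ S (i + 1))
    (hq : IsQuasiIso (subCx W S hS) W (fun i => (S i).subtype)) :
    ∃ h : ∀ i, W.V (i + 1) →ₗ[K] W.V i, (∀ i, ∀ x ∈ S (i + 1), h i x = 0) ∧
      ∀ i x, x - W.d i (h i x) - h (i + 1) (W.d (i + 1) x) ∈ S (i + 1) := by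
  have hac : ∀ n (x : W.V (n + 1)), W.d (n + 1) x ∈ S (n + 1 + 1) →
      ∃ y, x - W.d n y ∈ S (n + 1) := by
    intro n x hx
    obtain ⟨v, hv⟩ := (hq (n + 1)).1 ⟨_, hx⟩ (Subtype.ext (hW _ _)) ⟨x, rfl⟩
    have hv' : W.d (n + 1) v.1 = W.d (n + 1) x := congrArg Subtype.val hv
    obtain ⟨z, -, w, hw⟩ := (hq n).2 (x - v.1) (by rw [map_sub, hv', sub_self])
    refine ⟨w, ?_⟩
    rw [hw]
    have aux : ∀ a b : W.V (n + 1), a ∈ S (n + 1) → b ∈ S (n + 1) →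
        x - (x - a - b) ∈ S (n + 1) := by
      intro a b ha hb
      have : x - (x - a - b) = a + b := by abel
      rw [this]
      exact (S (n + 1)).add_mem ha hb
    exact aux _ _ v.2 z.2
  let dQ : ∀ i, (W.V i ⧸ S i) →ₗ[K] (W.V (i + 1) ⧸ S (i + 1)) := fun i =>
    (S i).mapQ (S (i + 1)) (W.d i) (hS i)
  have hdQ : ∀ i x, dQ i ((S i).mkQ x) = (S (i + 1)).mkQ (W.d i x) := fun i x => rfl
  have hdd : ∀ i x, dQ (i + 1) (dQ i x) = 0 := by
    intro i x
    obtain ⟨x, rfl⟩ := (S i).mkQ_surjective x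
    rw [hdQ, hdQ, hW, map_zero]
  have hacQ : ∀ n x, dQ (n + 1) x = 0 → ∃ y, dQ n y = x := by
    intro n x hx
    obtain ⟨x, rfl⟩ := (S _).mkQ_surjective x
    rw [hdQ] at hx
    obtain ⟨y, hy⟩ := hac n x (by simpa using hx)
    refine ⟨(S n).mkQ y, ?_⟩
    rw [hdQ]
    symm
    rw [← sub_eq_zero, ← map_sub]
    exact (Submodule.Quotient.mk_eq_zero _).2 hy
  choose u hu using fun i => exists_genInv (dQ i)
  have hs : ∀ i, ∃ s : (W.V i ⧸ S i) →ₗ[K] W.V i, (S i).mkQ ∘ₗ s = LinearMap.id := fun i =>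
    (S i).mkQ.exists_rightInverse_of_surjective (S i).range_mkQ
  choose s hs using hs
  have hs' : ∀ i x, (S i).mkQ (s i x) = x := fun i x => LinearMap.congr_fun (hs i) x
  let k : ∀ i, (W.V (i + 1) ⧸ S (i + 1)) →ₗ[K] (W.V i ⧸ S i) := fun i =>
    u i ∘ₗ (LinearMap.id - u (i + 1) ∘ₗ dQ (i + 1))
  have hk : ∀ i x, dQ i (k i x) + k (i + 1) (dQ (i + 1) x) = x := by
    intro i x
    have h1 : dQ (i + 1) (x - u (i + 1) (dQ (i + 1) x)) = 0 := by
      rw [map_sub, hu, sub_self]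
    obtain ⟨y, hy⟩ := hacQ i _ h1
    have h2 : k i x = u i (x - u (i + 1) (dQ (i + 1) x)) := rfl
    have h3 : k (i + 1) (dQ (i + 1) x) = u (i + 1) (dQ (i + 1) x) := by
      simp [k, hdd]
    rw [h2, h3, ← hy, hu, hy]; abel
  refine ⟨fun i => s i ∘ₗ k i ∘ₗ (S (i + 1)).mkQ, ?_, ?_⟩
  · intro i x hx
    have : (S (i + 1)).mkQ x = 0 := by simpa using hx
    simp only [LinearMap.comp_apply, this, map_zero]
  · intro i x
    rw [← Submodule.ker_mkQ (S (i + 1)), LinearMap.mem_ker]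
    simp only [LinearMap.comp_apply, map_sub]
    rw [← hdQ, hs', hs', ← hdQ, sub_sub, hk, sub_self]

lemma exists_ph (W : Cx K) (hW : W.IsComplex)
    (S : ∀ i, Submodule K (W.V i))
    (hS : ∀ i, ∀ x ∈ S i, W.d i x ∈ S (i + 1))
    (hq : IsQuasiIso (subCx W S hS) W (fun i => (S i).subtype)) :
    ∃ (h : ∀ i, W.V (i + 1) →ₗ[K] W.V i) (q : ∀ i, W.V i →ₗ[K] (subCx W S hS).V i),
      (∀ i, ∀ x ∈ S (i + 1), h i x = 0) ∧
      IsChainMap W (subCx W S hS) q ∧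
      (∀ i (x : S i), q i x.1 = x) ∧
      ∀ i x, W.d i (h i x) + h (i + 1) (W.d (i + 1) x) = x - (S (i + 1)).subtype (q (i + 1) x) := by
  obtain ⟨h, h0, hm⟩ := exists_h W hW S hS hq
  have : ∀ j, ∃ q : W.V j →ₗ[K] S j, ∀ i (e : i + 1 = j) (x : W.V (i + 1)),
      (q (castL K W.V e x)).1 =
        castL K W.V e (x - W.d i (h i x) - h (i + 1) (W.d (i + 1) x)) := by
    intro j
    obtain ⟨i, rfl⟩ : ∃ i, j = i + 1 := ⟨j - 1, by omega⟩
    refine ⟨LinearMap.codRestrict _ (LinearMap.id - W.d i ∘ₗ h i - h (i + 1) ∘ₗ W.d (i + 1))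
      (hm i), ?_⟩
    intro i' e x
    obtain rfl : i' = i := by omega
    rfl
  choose q hq' using this
  have hq1 : ∀ i x, (q (i + 1) x).1 = x - W.d i (h i x) - h (i + 1) (W.d (i + 1) x) :=
    fun i x => hq' (i + 1) i rfl x
  refine ⟨h, q, h0, ?_, ?_, ?_⟩
  · intro j x
    obtain ⟨i, rfl⟩ : ∃ i, j = i + 1 := ⟨j - 1, by omega⟩
    apply Subtype.ext
    show (q (i + 1 + 1) (W.d (i + 1) x)).1 = W.d (i + 1) (q (i + 1) x).1
    rw [hq1, hq1, hW, map_zero, map_sub, map_sub, hW]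
    abel
  · intro j x
    obtain ⟨i, rfl⟩ : ∃ i, j = i + 1 := ⟨j - 1, by omega⟩
    apply Subtype.ext
    refine (hq1 i x.1).trans ?_
    rw [h0 i _ x.2, h0 (i + 1) _ (hS _ _ x.2)]
    simp
  · intro i x
    have aux : ∀ a b c e : W.V (i + 1), e = a - b - c → b + c = a - e := by
      intro a b c e he; rw [he]; abel
    exact aux _ _ _ _ (hq1 i x)

section
variable (W : Cx K) (h : ∀ i, W.V (i + 1) →ₗ[K] W.V i)

/-- `h ∘ f`. -/
def postH (n : ℤ) (f : homV W W (n + 1)) : homV W W n := fun j =>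
  h (j + n) ∘ₗ castL K W.V (show j + (n + 1) = j + n + 1 by omega) ∘ₗ f j

/-- `f ∘ h`. -/
def preH (n : ℤ) (f : homV W W (n + 1)) : homV W W n := fun j =>
  castL K W.V (show j - 1 + (n + 1) = j + n by omega) ∘ₗ f (j - 1) ∘ₗ h (j - 1) ∘ₗ
    castL K W.V (show j = j - 1 + 1 by omega)

variable (p : ∀ i, W.V i →ₗ[K] W.V i)

lemma neg_one_zpow_succ (n : ℤ) : (-1 : K) ^ (n + 1) = - (-1 : K) ^ n := by
  rw [zpow_add_one₀ (by simp)]; simp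

lemma d_castL {i j : ℤ} (e : i = j) (x : W.V i) :
    W.d j (castL K W.V e x) = castL K W.V (by omega) (W.d i x) := by subst e; rfl

lemma h_castL {i j : ℤ} (e : i = j) (x : W.V (i + 1)) :
    h j (castL K W.V (by omega) x) = castL K W.V e (h i x) := by subst e; rfl

lemma p_castL {i j : ℤ} (e : i = j) (x : W.V i) :
    p j (castL K W.V e x) = castL K W.V e (p i x) := by subst e; rfl

lemma f_castL {n : ℤ} (f : homV W W n) {i j : ℤ} (e : i = j) (x : W.V i) :
    f j (castL K W.V e x) = castL K W.V (by omega) (f i x) := by subst e; rfl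

lemma homD_postH
    (hp : ∀ i x, W.d i (h i x) + h (i + 1) (W.d (i + 1) x) = x - p (i + 1) x)
    (n : ℤ) (f : homV W W (n + 1)) (hf : homD W W (n + 1) f = 0) :
    homD W W n (postH W h n f) = f - sandwich (fun _ => LinearMap.id) p (n + 1) f := by
  funext j
  apply LinearMap.ext
  intro x
  have hx := LinearMap.congr_fun (congrFun hf j) x
  rw [homD_apply'] at hx
  simp only [Pi.zero_apply, LinearMap.zero_apply, neg_one_zpow_succ, neg_smul, sub_neg_eq_add] at hx
  have e1 : j + (n + 1) = j + n + 1 := by omega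
  have key := hp (j + n) (castL K W.V e1 (f j x))
  rw [homD_apply']
  simp only [postH, sandwich, LinearMap.comp_apply, Pi.sub_apply, LinearMap.sub_apply,
    LinearMap.id_apply]
  rw [d_castL, p_castL] at key
  have hx2 := congrArg (castL K W.V (show j + (n + 1 + 1) = j + n + 1 + 1 by omega)) hx
  rw [map_add, map_smul, map_zero, castL_castL, castL_castL] at hx2
  rw [eq_neg_of_add_eq_zero_left hx2] at key
  have key2 := congrArg (castL K W.V e1.symm) key
  simp only [map_add, map_sub, map_neg, map_smul, castL_castL, castL_self] at key2
  rw [← key2, ← sub_eq_add_neg]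
  congr 2
  have aux : ∀ (a b c k : ℤ) (e : a = b) (e1 : c = a + 1) (e2 : c = b + 1) (e3 : a = k)
      (e4 : b = k) (y : W.V c), castL K W.V e3 (h a (castL K W.V e1 y)) =
        castL K W.V e4 (h b (castL K W.V e2 y)) := by
    intro a b c k e e1 e2 e3 e4 y
    subst e; rfl
  exact aux _ _ _ _ (by omega) _ _ _ _ _

lemma homD_preH
    (hp : ∀ i x, W.d i (h i x) + h (i + 1) (W.d (i + 1) x) = x - p (i + 1) x)
    (n : ℤ) (f : homV W W (n + 1)) (hf : homD W W (n + 1) f = 0) :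
    homD W W n ((-1 : K) ^ (n + 1) • preH W h n f) =
      f - sandwich p (fun _ => LinearMap.id) (n + 1) f := by
  funext j
  apply LinearMap.ext
  intro x
  obtain ⟨i, rfl⟩ : ∃ i, j = i + 1 := ⟨j - 1, by omega⟩
  have hx := LinearMap.congr_fun (congrFun hf i) (h i x)
  rw [homD_apply'] at hx
  have key := congrArg (f (i + 1)) (hp i x)
  have ha : preH W h n f (i + 1) x =
      castL K W.V (show i + (n + 1) = i + 1 + n by omega) (f i (h i x)) := by
    have : ∀ k (e : i = k), castL K W.V (show k + (n + 1) = i + 1 + n by omega) (f k (h k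
      (castL K W.V (show i + 1 = k + 1 by omega) x))) =
      castL K W.V (show i + (n + 1) = i + 1 + n by omega) (f i (h i x)) := by
      intro k e; subst e; rfl
    exact this (i + 1 - 1) (by omega)
  have hb : ∀ y, preH W h n f (i + 1 + 1) y =
      castL K W.V (show i + 1 + (n + 1) = i + 1 + 1 + n by omega) (f (i + 1) (h (i + 1) y)) := by
    intro y
    have : ∀ k (e : i + 1 = k), castL K W.V (show k + (n + 1) = i + 1 + 1 + n by omega) (f k (h k
      (castL K W.V (show i + 1 + 1 = k + 1 by omega) y))) =
      castL K W.V (show i + 1 + (n + 1) = i + 1 + 1 + n by omega) (f (i + 1) (h (i + 1) y)) := by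
      intro k e; subst e; rfl
    exact this (i + 1 + 1 - 1) (by omega)
  rw [map_smul]
  simp only [Pi.smul_apply, LinearMap.smul_apply]
  rw [homD_apply', ha, hb]
  simp only [sandwich, LinearMap.comp_apply, Pi.sub_apply, LinearMap.sub_apply,
    LinearMap.id_apply]
  rw [map_add, map_sub] at key
  rw [← key]
  rw [d_castL]
  have hx2 := congrArg (castL K W.V (show i + (n + 1 + 1) = i + 1 + (n + 1) by omega)) hx
  simp only [map_sub, map_smul, castL_castL, castL_self, Pi.zero_apply, LinearMap.zero_apply,
    map_zero] at hx2 ⊢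
  rw [sub_eq_zero.1 hx2, neg_one_zpow_succ, smul_sub, smul_smul, smul_smul]
  have : (-1 : K) ^ n * (-1 : K) ^ n = 1 := by
    rw [← mul_zpow]; simp
  simp [this]
end

lemma coe_castL_sub (W : Cx K) (S : ∀ i, Submodule K (W.V i))
    (hS : ∀ i, ∀ x ∈ S i, W.d i x ∈ S (i + 1)) {i j : ℤ} (e : i = j) (x : S i) :
    (S j).subtype (castL K (subCx W S hS).V e x) = castL K W.V e x.1 := by subst e; rfl

/-- Let `V ⊆ W` be a subcomplex (given by submodules `S i ⊆ W^i` preserved by the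
differential) such that the inclusion `V → W` is a quasi-isomorphism.  Then both
the inclusion `L_{V,W} → Hom*(W, W)` and the restriction `L_{V,W} → Hom*(V, V)`,
`f ↦ f|_V`, are quasi-isomorphisms, where `L_{V,W} ⊆ Hom*(W, W)` is the
subcomplex of homogeneous maps preserving `V`. -/
theorem presCx_quasiIso (W : Cx K) (hW : W.IsComplex)
    (S : ∀ i, Submodule K (W.V i))
    (hS : ∀ i, ∀ x ∈ S i, W.d i x ∈ S (i + 1))
    (hq : IsQuasiIso (subCx W S hS) W (fun i => (S i).subtype)) :
    (IsChainMap (presCx W S hS) (homCx W W) (fun n => (presSub W S n).subtype) ∧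
      IsQuasiIso (presCx W S hS) (homCx W W) (fun n => (presSub W S n).subtype)) ∧
    (IsChainMap (presCx W S hS) (homCx (subCx W S hS) (subCx W S hS)) (resMap W S hS) ∧
      IsQuasiIso (presCx W S hS) (homCx (subCx W S hS) (subCx W S hS)) (resMap W S hS)) := by
  obtain ⟨h, q, h0, hqc, hqid, hhom⟩ := exists_ph W hW S hS hq
  have hι : IsChainMap (subCx W S hS) W (fun i => (S i).subtype) := fun i x => rfl
  let p : ∀ i, W.V i →ₗ[K] W.V i := fun i => (S i).subtype ∘ₗ q i
  have hpS : ∀ i x, p i x ∈ S i := fun i x => (q i x).2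
  have hpc : IsChainMap W W p := by
    intro i x
    have := congrArg (S (i + 1)).subtype (hqc i x)
    exact this
  have hid : IsChainMap W W (fun _ => LinearMap.id) := fun i x => rfl
  have hp : ∀ i x, W.d i (h i x) + h (i + 1) (W.d (i + 1) x) = x - p (i + 1) x := hhom
  have hres : IsChainMap (presCx W S hS) (homCx (subCx W S hS) (subCx W S hS))
      (resMap W S hS) := by
    intro n f
    funext j
    apply LinearMap.ext
    intro x
    apply Subtype.ext
    have h1 := coe_castL_sub W S hS (show j + n + 1 = j + (n + 1) by omega)
      ((subCx W S hS).d (j + n) (resMap W S hS n f j x))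
    have h2 := coe_castL_sub W S hS (show j + 1 + n = j + (n + 1) by omega)
      (resMap W S hS n f (j + 1) ((subCx W S hS).d j x))
    exact (congrArg₂ (fun a b => a - (-1 : K) ^ n • b) h1 h2).symm
  have postmem : ∀ n (f : homV W W (n + 1)), f ∈ presSub W S (n + 1) →
      postH W h n f ∈ presSub W S n := by
    intro n f hf j x hx
    have : postH W h n f j x = 0 := h0 _ _ (castL_mem S _ (hf j x hx))
    rw [this]; exact zero_mem _
  have premem : ∀ n (f : homV W W (n + 1)), preH W h n f ∈ presSub W S n := by
    intro n f j x hx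
    have h1 : h (j - 1) (castL K W.V (show j = j - 1 + 1 by omega) x) = 0 :=
      h0 _ _ (castL_mem S _ hx)
    have : preH W h n f j x = 0 := by
      simp only [preH, LinearMap.comp_apply, h1, map_zero]
    rw [this]; exact zero_mem _
  have aux : ∀ (n : ℤ) (a b c x : homV W W n), a = c → b = x - c → a + b = x := by
    intro n a b c x h1 h2; rw [h1, h2]; abel
  refine ⟨⟨fun n f => rfl, fun n => ⟨?_, ?_⟩⟩, hres, fun n => ⟨?_, ?_⟩⟩
  · rintro ⟨x, hx⟩ hdx ⟨w, hw⟩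
    have hdx' : homD W W (n + 1) x = 0 := congrArg Subtype.val hdx
    have hw' : homD W W n w = x := hw
    refine ⟨⟨sandwich (fun _ => LinearMap.id) p n w + postH W h n x,
      add_mem (fun j y _ => hpS _ _) (postmem n x hx)⟩, ?_⟩
    apply Subtype.ext
    show homD W W n (sandwich (fun _ => LinearMap.id) p n w + postH W h n x) = x
    refine (map_add (homD W W n) _ _).trans (aux _ _ _ _ _ ?_ (homD_postH W h p hp n x hdx'))
    exact (homD_sandwich _ _ hid hpc n w).trans
      (congrArg (sandwich (fun _ => LinearMap.id) p (n + 1)) hw')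
  · intro y hy
    have hy' : homD W W (n + 1) y = 0 := hy
    refine ⟨⟨sandwich (fun _ => LinearMap.id) p (n + 1) y, fun j y _ => hpS _ _⟩, ?_,
      postH W h n y, homD_postH W h p hp n y hy'⟩
    apply Subtype.ext
    show homD W W (n + 1) (sandwich (fun _ => LinearMap.id) p (n + 1) y) = 0
    refine (homD_sandwich _ _ hid hpc (n + 1) y).trans
      ((congrArg (sandwich (fun _ => LinearMap.id) p (n + 1 + 1)) hy').trans ?_)
    funext j
    apply LinearMap.ext
    intro x
    simp [sandwich]
  · rintro ⟨x, hx⟩ hdx ⟨w, hw⟩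
    have hdx' : homD W W (n + 1) x = 0 := congrArg Subtype.val hdx
    have hw' : homD (subCx W S hS) (subCx W S hS) n w = resMap W S hS (n + 1) ⟨x, hx⟩ := hw
    refine ⟨⟨sandwich q (fun i => (S i).subtype) n w + (-1 : K) ^ (n + 1) • preH W h n x,
      add_mem (fun j y _ => (w j (q j y)).2) (Submodule.smul_mem _ _ (premem n x))⟩, ?_⟩
    apply Subtype.ext
    show homD W W n (sandwich q (fun i => (S i).subtype) n w +
      (-1 : K) ^ (n + 1) • preH W h n x) = x
    refine (map_add (homD W W n) _ _).trans (aux _ _ _ _ _ ?_ (homD_preH W h p hp n x hdx'))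
    exact (homD_sandwich q _ hqc hι n w).trans
      (congrArg (sandwich (B := subCx W S hS) (B' := W) q (fun i => (S i).subtype) (n + 1)) hw')
  · intro y hy
    have hy' : homD (subCx W S hS) (subCx W S hS) (n + 1) y = 0 := hy
    refine ⟨⟨sandwich q (fun i => (S i).subtype) (n + 1) y,
      fun j z _ => (y j (q j z)).2⟩, ?_, 0, ?_⟩
    · apply Subtype.ext
      show homD W W (n + 1) (sandwich q (fun i => (S i).subtype) (n + 1) y) = 0
      refine (homD_sandwich q _ hqc hι (n + 1) y).trans ((congrArg
        (sandwich (B := subCx W S hS) (B' := W) q (fun i => (S i).subtype) (n + 1 + 1))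
          hy').trans ?_)
      funext j
      apply LinearMap.ext
      intro x
      rfl
    · rw [map_zero]
      symm
      rw [sub_eq_zero]
      funext j
      apply LinearMap.ext
      intro x
      apply Subtype.ext
      exact (congrArg (fun z => (S (j + (n + 1))).subtype (y j z)) (hqid j x)).symm
end

section
/- Let V be a subcomplex of a cochain complex (W, d) of vector spaces over a field K such that the induced map H^n(V) → H^n(W) is injective for every n. Then: (1) B^n(V) = V^n ∩ B^n(W) for every n, where B^n denotes coboundaries; and (2) there exists a graded subspace H_W ⊆ Z*(W) of the cocycles of W such that H_W ⊕ B*(W) = Z*(W) in every degree and (H_W ∩ V) ⊕ B*(V) = Z*(V) in every degree. -/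
universe u

variable {K : Type u} [Field K]

/-- The submodule `B^i(W) ⊆ W^i` of coboundaries. -/
def Bdry (W : Cx K) (i : ℤ) : Submodule K (W.V i) :=
  (LinearMap.range (W.d (i - 1))).map (castL K W.V (by omega : i - 1 + 1 = i))

/-- The submodule `B^i(V) ⊆ W^i` of coboundaries of the subcomplex `V` given by a
family of submodules `S`. -/
def BdryS (W : Cx K) (S : ∀ i, Submodule K (W.V i)) (i : ℤ) : Submodule K (W.V i) :=
  ((S (i - 1)).map (W.d (i - 1))).map (castL K W.V (by omega : i - 1 + 1 = i))

theorem lat_aux {M : Type u} [AddCommGroup M] [Module K M] (Z B S : Submodule K M) (hB : B ≤ Z) :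
    ∃ H : Submodule K M, H ≤ Z ∧ H ⊔ B = Z ∧ H ⊓ B = ⊥ ∧ (H ⊓ S) ⊔ (S ⊓ B) = Z ⊓ S ∧
      (H ⊓ S) ⊓ (S ⊓ B) = ⊥ := by
  obtain ⟨C, hC⟩ := exists_isCompl (S ⊓ B)
  have key : ∀ (P Q R : Submodule K M), IsCompl P Q → Q ≤ R → (P ⊓ R) ⊔ Q = R := by
    intro P Q R h hQ
    rw [sup_comm, ← sup_inf_assoc_of_le P hQ, sup_comm, h.sup_eq_top, top_inf_eq]
  have hd : Disjoint (C ⊓ (Z ⊓ S)) B := by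
    rw [Submodule.disjoint_def]
    rintro x ⟨h1, h2, h3⟩ h4
    exact (Submodule.disjoint_def.1 hC.disjoint) x ⟨h3, h4⟩ h1
  obtain ⟨H, hle, hH⟩ := hd.exists_isCompl
  have hb : H ⊓ Z ⊓ B = ⊥ := by
    rw [eq_bot_iff, ← hH.inf_eq_bot]
    exact inf_le_inf_right _ inf_le_left
  refine ⟨H ⊓ Z, inf_le_right, key _ _ _ hH hB, hb, ?_, ?_⟩
  · apply le_antisymm
    · exact sup_le (inf_le_inf_right _ inf_le_right)
        (le_inf (inf_le_right.trans hB) inf_le_left)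
    · have h1 := key C (S ⊓ B) (Z ⊓ S) hC.symm (le_inf (inf_le_right.trans hB) inf_le_left)
      conv_lhs => rw [← h1]
      refine sup_le_sup_right (le_inf (le_inf hle ?_) ?_) _
      · exact inf_le_right.trans inf_le_left
      · exact inf_le_right.trans inf_le_right
  · rw [eq_bot_iff, ← hb]
    exact inf_le_inf inf_le_left inf_le_right

theorem bdry_aux (W : Cx K) (hW : W.IsComplex)
    (S : ∀ i, Submodule K (W.V i))
    (hS : ∀ i, ∀ x ∈ S i, W.d i x ∈ S (i + 1))
    (hinj : ∀ (n : ℤ) (x : W.V (n + 1)), x ∈ S (n + 1) → W.d (n + 1) x = 0 →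
      (∃ y, W.d n y = x) → ∃ y ∈ S n, W.d n y = x) (n j : ℤ) (h : n + 1 = j) :
    ((S n).map (W.d n)).map (castL K W.V h) =
      S j ⊓ (LinearMap.range (W.d n)).map (castL K W.V h) ∧
    (LinearMap.range (W.d n)).map (castL K W.V h) ≤ LinearMap.ker (W.d j) := by
  subst h
  have hc : castL K W.V (rfl : n + 1 = n + 1) = LinearMap.id := rfl
  rw [hc, Submodule.map_id, Submodule.map_id]
  constructor
  · ext x
    constructor
    · rintro ⟨y, hy, rfl⟩
      exact ⟨hS n y hy, y, rfl⟩
    · rintro ⟨hx, y, rfl⟩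
      exact hinj n _ hx (hW n y) ⟨y, rfl⟩
  · rintro _ ⟨y, rfl⟩
    exact hW n y

/-- Let `V ⊆ W` be a subcomplex (given by submodules `S i ⊆ W^i` preserved by
the differential) such that the induced maps `H^n(V) → H^n(W)` are injective
for every `n`.  Then:
(1) `B^n(V) = V^n ∩ B^n(W)` in every degree; and
(2) there is a graded subspace `H_W` of the cocycles of `W` with
`H_W ⊕ B*(W) = Z*(W)` in every degree and `(H_W ∩ V) ⊕ B*(V) = Z*(V)` in every
degree (here `Z*(V) = V ∩ Z*(W)`, and direct sums are internal:  the two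
summands intersect trivially and span). -/
theorem harmonic_representatives (W : Cx K) (hW : W.IsComplex)
    (S : ∀ i, Submodule K (W.V i))
    (hS : ∀ i, ∀ x ∈ S i, W.d i x ∈ S (i + 1))
    (hinj : ∀ (n : ℤ) (x : W.V (n + 1)), x ∈ S (n + 1) → W.d (n + 1) x = 0 →
      (∃ y, W.d n y = x) → ∃ y ∈ S n, W.d n y = x) :
    (∀ i, BdryS W S i = S i ⊓ Bdry W i) ∧
    (∃ H : ∀ i, Submodule K (W.V i),
      (∀ i, H i ≤ LinearMap.ker (W.d i)) ∧
      (∀ i, H i ⊔ Bdry W i = LinearMap.ker (W.d i)) ∧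
      (∀ i, H i ⊓ Bdry W i = ⊥) ∧
      (∀ i, (H i ⊓ S i) ⊔ BdryS W S i = LinearMap.ker (W.d i) ⊓ S i) ∧
      (∀ i, (H i ⊓ S i) ⊓ BdryS W S i = ⊥)) := by
  have h1 : ∀ i, BdryS W S i = S i ⊓ Bdry W i := fun i =>
    (bdry_aux W hW S hS hinj (i - 1) i (by omega)).1
  have h2 : ∀ i, Bdry W i ≤ LinearMap.ker (W.d i) := fun i =>
    (bdry_aux W hW S hS hinj (i - 1) i (by omega)).2
  refine ⟨h1, ?_⟩
  choose H hH using fun i => lat_aux (LinearMap.ker (W.d i)) (Bdry W i) (S i) (h2 i)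
  refine ⟨H, fun i => (hH i).1, fun i => (hH i).2.1, fun i => (hH i).2.2.1, fun i => ?_, fun i => ?_⟩
  · rw [h1]
    exact (hH i).2.2.2.1
  · rw [h1]
    exact (hH i).2.2.2.2
end
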